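/- Concentration of the initial misfit: let φ_1, …, φ_K : ℝ → ℝ each be bounded by B and B-Lipschitz on ℝ, and suppose ‖x̃_j‖ = 1 for all j = 1, …, m. Suppose α ∈ ℝ^K satisfies K‖α‖_∞ ≤ 1 and Σ_{k=1}^K α_k E_{z∼N(0,1)}[φ_k(z)] = 0, and c ∈ ℝ^N satisfies |c_i| = ‖y‖/(K √(m N)) for every i. Let v_1, …, v_N be i.i.d. N(0, I_{d+1}) and define the initial network outputs u_j = Σ_{i=1}^N c_i Σ_{k=1}^K α_k φ_k(v_iᵀ x̃_j). Then for every δ > 0, with probability at least 1 − exp(−m δ² / (2‖X‖²)), the initial residual satisfies ‖(u_j − y_j)_{j=1}^m‖ ≤ ‖y‖ (1 + (1 + δ) B / K), i.e. √(2 L(0)) ≤ ‖y‖ (1 + (1 + δ) B / K). -/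

import Mathlib

open MeasureTheory ProbabilityTheory
open scoped BigOperators

noncomputable section

/-- Euclidean norm of a finitely-indexed real vector. -/
def euclNorm {ι : Type*} [Fintype ι] (u : ι → ℝ) : ℝ := Real.sqrt (∑ i, (u i) ^ 2)

/-- Spectral (operator) norm of a real matrix: the supremum of `‖A x‖` over the Euclidean
unit ball. -/
def specNorm {ι κ : Type*} [Fintype ι] [Fintype κ] (A : Matrix ι κ ℝ) : ℝ :=
  ⨆ x : {x : κ → ℝ // euclNorm x ≤ 1}, euclNorm (A.mulVec x)

open scoped MeasureTheory Convolution

section conc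
variable {E : Type*} [NormedAddCommGroup E] [InnerProductSpace ℝ E] [FiniteDimensional ℝ E]
  [MeasurableSpace E] [BorelSpace E]

/-- The class of bounded, `L`-Lipschitz, `C^{1,1}` functions. -/
structure GoodFn (L M C : ℝ) (g : E → ℝ) (p : E → StrongDual ℝ E) : Prop where
  lip : ∀ x y, |g x - g y| ≤ L * ‖x - y‖
  bdd : ∀ x, |g x| ≤ C
  pbd : ∀ x, ‖p x‖ ≤ L
  plip : ∀ x y, ‖p x - p y‖ ≤ M * ‖x - y‖
  rem : ∀ x h, |g (x + h) - g x - p x h| ≤ M * ‖h‖ ^ 2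

lemma cont_of_lip {F G : Type*} [NormedAddCommGroup F] [NormedAddCommGroup G] {L : ℝ} {g : F → G}
    (h : ∀ x y, ‖g x - g y‖ ≤ L * ‖x - y‖) : Continuous g := by
  refine (LipschitzWith.of_dist_le_mul (K := L.toNNReal) fun x y => ?_).continuous
  rw [dist_eq_norm, dist_eq_norm]
  exact (h x y).trans (by gcongr; exact Real.le_coe_toNNReal L)

lemma integrable_bdd {F G : Type*} [NormedAddCommGroup G] [TopologicalSpace F]
    [MeasurableSpace F] [OpensMeasurableSpace F] [SecondCountableTopologyEither F G]
    {μ : Measure F} [IsFiniteMeasure μ]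
    {g : F → G} (C : ℝ) (hc : Continuous g) (h : ∀ x, ‖g x‖ ≤ C) : Integrable g μ :=
  Integrable.of_bound hc.aestronglyMeasurable C (Filter.Eventually.of_forall h)

/-- Gaussian smoothing. -/
def gT {F : Type*} [NormedAddCommGroup F] [NormedSpace ℝ F] (s : ℝ) (g : E → F) (x : E) : F :=
  ∫ z, g (x + s • z) ∂(stdGaussian E)

lemma GoodFn.smooth {L M C : ℝ} {g : E → ℝ} {p : E → StrongDual ℝ E} (hg : GoodFn L M C g p)
    (s : ℝ) : GoodFn L M C (gT s g) (gT s p) := by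
  have cg : Continuous g := cont_of_lip hg.lip
  have cp : Continuous p := cont_of_lip hg.plip
  have ig : ∀ x, Integrable (fun z => g (x + s • z)) (stdGaussian E) := fun x =>
    integrable_bdd C (by fun_prop) (fun _ => hg.bdd _)
  have ip : ∀ x, Integrable (fun z => p (x + s • z)) (stdGaussian E) := fun x =>
    integrable_bdd L (by fun_prop) (fun _ => hg.pbd _)
  refine ⟨fun x y => ?_, fun x => ?_, fun x => ?_, fun x y => ?_, fun x h => ?_⟩
  · rw [gT, gT, ← integral_sub (ig x) (ig y), ← Real.norm_eq_abs]
    refine (norm_integral_le_of_norm_le_const (C := L * ‖x - y‖) (.of_forall fun z => ?_)).trans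
      (by simp)
    simpa using hg.lip (x + s • z) (y + s • z)
  · rw [gT, ← Real.norm_eq_abs]
    exact (norm_integral_le_of_norm_le_const (C := C) (.of_forall fun z => hg.bdd _)).trans
      (by simp)
  · rw [gT]
    exact (norm_integral_le_of_norm_le_const (C := L) (.of_forall fun z => hg.pbd _)).trans
      (by simp)
  · rw [gT, gT, ← integral_sub (ip x) (ip y)]
    refine (norm_integral_le_of_norm_le_const (C := M * ‖x - y‖) (.of_forall fun z => ?_)).trans
      (by simp)
    simpa using hg.plip (x + s • z) (y + s • z)
  · rw [gT, gT, gT, ContinuousLinearMap.integral_apply (ip x), ← integral_sub (ig _) (ig _)]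
    have i3 : Integrable (fun z => g (x + h + s • z) - g (x + s • z)) (stdGaussian E) :=
      (ig _).sub (ig _)
    rw [← integral_sub i3 ((ip x).apply_continuousLinearMap h), ← Real.norm_eq_abs]
    refine (norm_integral_le_of_norm_le_const (C := M * ‖h‖ ^ 2) (.of_forall fun z => ?_)).trans
      (by simp)
    have := hg.rem (x + s • z) h
    rw [Real.norm_eq_abs, add_right_comm x h]
    exact this

lemma gauss_rot (s : ℝ) (g : E → ℝ) (hc : Continuous g) (C : ℝ) (hb : ∀ x, |g x| ≤ C) (x : E) :
    gT s (gT s g) x = gT (√2 * s) g x := by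
  have hconv : (stdGaussian E) ∗ (stdGaussian E) = (stdGaussian E).map (fun z => (√2) • z) := by
    have : IsProbabilityMeasure ((stdGaussian E).map (fun z => (√2) • z)) :=
      Measure.isProbabilityMeasure_map (by fun_prop)
    apply Measure.ext_of_charFun
    ext t
    rw [charFun_conv, charFun_map_smul, charFun_stdGaussian, charFun_stdGaussian, ← Complex.exp_add]
    congr 1
    rw [← Complex.ofReal_pow, ← Complex.ofReal_pow, norm_smul, mul_pow, Real.norm_eq_abs, sq_abs,
      Real.sq_sqrt (by norm_num)]
    push_cast
    ring
  have hi : Integrable (fun w => g (x + s • w)) ((stdGaussian E) ∗ (stdGaussian E)) :=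
    integrable_bdd C (by fun_prop) (fun _ => hb _)
  have h1 := integral_conv hi
  rw [hconv, integral_map (by fun_prop)
    (Continuous.aestronglyMeasurable (by fun_prop))] at h1
  simp only [gT]
  simp only [smul_add, smul_smul, ← add_assoc] at h1
  rw [← h1]
  simp [mul_comm]

lemma integrable_exp_norm (a : ℝ) :
    Integrable (fun z : E => Real.exp (a * ‖z‖)) (stdGaussian E) := by
  obtain ⟨c, hc, hi⟩ := IsGaussian.exists_integrable_exp_sq (stdGaussian E)
  refine (hi.const_mul (Real.exp (a ^ 2 / (4 * c)))).mono'
    (Continuous.aestronglyMeasurable (by fun_prop)) (.of_forall fun z => ?_)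
  rw [Real.norm_eq_abs, abs_of_pos (Real.exp_pos _), ← Real.exp_add]
  apply Real.exp_le_exp.2
  have : a ^ 2 / (4 * c) + c * ‖z‖ ^ 2 - a * ‖z‖ = (2 * c * ‖z‖ - a) ^ 2 / (4 * c) := by
    field_simp; ring
  have : 0 ≤ (2 * c * ‖z‖ - a) ^ 2 / (4 * c) := by positivity
  linarith

lemma exp_taylor_le (D : ℝ) :
    Real.exp D ≤ 1 + D + D ^ 2 / 2 + |D| ^ 3 * Real.exp |D| := by
  have h := Complex.norm_exp_sub_sum_le_norm_mul_exp (D : ℂ) 3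
  have e : Complex.exp D - ∑ m ∈ Finset.range 3, (D : ℂ) ^ m / m.factorial =
      ((Real.exp D - (1 + D + D ^ 2 / 2) : ℝ) : ℂ) := by
    simp [Finset.sum_range_succ]
  rw [e, Complex.norm_real, Complex.norm_real, Real.norm_eq_abs, Real.norm_eq_abs] at h
  have := le_abs_self (Real.exp D - (1 + D + D ^ 2 / 2))
  linarith

set_option maxHeartbeats 1000000 in
lemma base_bound (L M C : ℝ) (hL : 0 ≤ L) (hM : 0 ≤ M) : ∃ Q : ℝ, 0 ≤ Q ∧
    ∀ (g : E → ℝ) (p : E → StrongDual ℝ E), GoodFn L M C g p → ∀ s : ℝ, 0 ≤ s → s ≤ 1 → ∀ x,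
      gT s (fun x => Real.exp (g x)) x ≤
        Real.exp (gT s g x + (s ^ 2 * L ^ 2 / 2 + s ^ 3 * Q)) := by
  set γ := stdGaussian E with hγ
  have in1 : Integrable (fun z : E => ‖z‖) γ := IsGaussian.integrable_id.norm
  have in2 : Integrable (fun z : E => ‖z‖ ^ 2) γ :=
    (IsGaussian.memLp_two_id (μ := γ)).integrable_norm_pow (by norm_num)
  set q := ∫ z, ‖z‖ ∂γ with hq
  set q2 := ∫ z, ‖z‖ ^ 2 ∂γ with hq2
  have q0 : 0 ≤ q := integral_nonneg fun _ => norm_nonneg _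
  have q20 : 0 ≤ q2 := integral_nonneg fun _ => by positivity
  set A := L * (1 + q) with hA
  set A' := M * (1 + q2) with hA'
  have A0 : 0 ≤ A := by positivity
  have A'0 : 0 ≤ A' := by positivity
  set H : E → ℝ := fun z => L * A' * (1 + ‖z‖) ^ 3 + A' ^ 2 * (1 + ‖z‖) ^ 4 +
    A ^ 3 * (1 + ‖z‖) ^ 3 * Real.exp (A * (1 + ‖z‖)) with hH
  have H0 : ∀ z, 0 ≤ H z := fun z => by positivity
  have iH : Integrable H γ := by
    refine (((integrable_exp_norm (E := E) (1 + A)).const_mul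
      ((L * A' * 6 + A' ^ 2 * 24 + A ^ 3 * 6) * Real.exp (1 + A)))).mono'
      (Continuous.aestronglyMeasurable (by fun_prop)) (.of_forall fun z => ?_)
    rw [Real.norm_eq_abs, abs_of_nonneg (H0 z), mul_assoc, ← Real.exp_add,
      show 1 + A + (1 + A) * ‖z‖ = (1 + ‖z‖) + A * (1 + ‖z‖) by ring, Real.exp_add]
    have w0 : 0 ≤ 1 + ‖z‖ := by positivity
    have e3 : (1 + ‖z‖) ^ 3 ≤ 6 * Real.exp (1 + ‖z‖) := by
      have := Real.pow_div_factorial_le_exp (1 + ‖z‖) w0 3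
      norm_num [Nat.factorial] at this
      linarith
    have e4 : (1 + ‖z‖) ^ 4 ≤ 24 * Real.exp (1 + ‖z‖) := by
      have := Real.pow_div_factorial_le_exp (1 + ‖z‖) w0 4
      norm_num [Nat.factorial] at this
      linarith
    have eA : 1 ≤ Real.exp (A * (1 + ‖z‖)) := Real.one_le_exp (by positivity)
    have e3' : (1 + ‖z‖) ^ 3 ≤ 6 * (Real.exp (1 + ‖z‖) * Real.exp (A * (1 + ‖z‖))) :=
      e3.trans (by nlinarith [Real.exp_pos (1 + ‖z‖)])
    have e4' : (1 + ‖z‖) ^ 4 ≤ 24 * (Real.exp (1 + ‖z‖) * Real.exp (A * (1 + ‖z‖))) :=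
      e4.trans (by nlinarith [Real.exp_pos (1 + ‖z‖)])
    have t1 := mul_le_mul_of_nonneg_left e3' (show 0 ≤ L * A' by positivity)
    have t2 := mul_le_mul_of_nonneg_left e4' (show 0 ≤ A' ^ 2 by positivity)
    have t3 := mul_le_mul_of_nonneg_left e3
      (show 0 ≤ A ^ 3 * Real.exp (A * (1 + ‖z‖)) by positivity)
    simp only [hH]
    linarith
  refine ⟨∫ z, H z ∂γ, integral_nonneg H0, fun g p hg s hs0 hs1 x => ?_⟩
  have cg : Continuous g := cont_of_lip hg.lip
  have ig : Integrable (fun z => g (x + s • z)) γ :=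
    integrable_bdd C (by fun_prop) (fun _ => hg.bdd _)
  have ipz : Integrable (fun z => p x z) γ :=
    (p x).integrable_comp IsGaussian.integrable_id
  have ipz2 : Integrable (fun z => (p x z) ^ 2) γ := by
    have := (IsGaussian.memLp_two_id (μ := γ)).continuousLinearMap_comp (p x)
    exact this.integrable_sq
  have pz0 : ∫ z, p x z ∂γ = 0 := integral_strongDual_stdGaussian (p x)
  have pz2 : ∫ z, (p x z) ^ 2 ∂γ = ‖p x‖ ^ 2 := by
    rw [← variance_dual_stdGaussian (p x), variance_of_integral_eq_zero]
    · exact (p x).continuous.aemeasurable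
    · exact pz0
  set G := gT s g x with hG
  have hGe : G = ∫ z, g (x + s • z) ∂γ := rfl
  have hD1 : ∀ z, |g (x + s • z) - G| ≤ s * A * (1 + ‖z‖) := by
    intro z
    have : g (x + s • z) - G = ∫ z', (g (x + s • z) - g (x + s • z')) ∂γ := by
      rw [integral_sub (integrable_const _) ig]; simp [hGe]
    rw [this, ← Real.norm_eq_abs]
    have b : ∀ z', ‖g (x + s • z) - g (x + s • z')‖ ≤ L * s * ‖z‖ + L * s * ‖z'‖ := by
      intro z'
      refine (hg.lip _ _).trans ?_
      have : x + s • z - (x + s • z') = s • (z - z') := by rw [smul_sub]; abel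
      rw [this, norm_smul, Real.norm_eq_abs, abs_of_nonneg hs0, ← mul_assoc, ← mul_add]
      exact mul_le_mul_of_nonneg_left (norm_sub_le _ _) (by positivity)
    refine (norm_integral_le_of_norm_le ((integrable_const _).add (in1.const_mul (L * s)))
      (.of_forall b)).trans ?_
    rw [integral_add' (integrable_const _) (in1.const_mul (L * s)), integral_const_mul (L * s) (fun z : E => ‖z‖), ← hq]
    simp only [integral_const, probReal_univ, one_smul, hA]
    have : 0 ≤ L * s := by positivity
    have : 0 ≤ ‖z‖ * q * (L * s) := by positivity
    nlinarith
  have hD2 : ∀ z, |g (x + s • z) - G - s * p x z| ≤ s ^ 2 * A' * (1 + ‖z‖) ^ 2 := by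
    intro z
    have i0 : Integrable (fun z' => (g (x + s • z') - g x)  - s * p x z') γ :=
      (ig.sub (integrable_const _)).sub (ipz.const_mul s)
    have : g (x + s • z) - G - s * p x z = ∫ z', ((g (x + s • z) - g x  - s * p x z) -
        (g (x + s • z') - g x  - s * p x z')) ∂γ := by
      rw [integral_sub (integrable_const _) i0,
        integral_sub (f := fun z' => g (x + s • z') - g x) (ig.sub (integrable_const _))
          (ipz.const_mul s),
        integral_sub ig (integrable_const _), integral_const_mul, pz0]; simp [hGe]; ring
    rw [this, ← Real.norm_eq_abs]
    have b0 : ∀ z', |g (x + s • z') - g x - s * p x z'| ≤ M * s ^ 2 * ‖z'‖ ^ 2 := by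
      intro z'
      have := hg.rem x (s • z')
      rw [norm_smul, map_smul, mul_pow, Real.norm_eq_abs, sq_abs, smul_eq_mul, ← mul_assoc] at this
      exact this
    have b : ∀ z', ‖(g (x + s • z) - g x  - s * p x z) -
        (g (x + s • z') - g x  - s * p x z')‖ ≤ M * s ^ 2 * ‖z‖ ^ 2 + M * s ^ 2 * ‖z'‖ ^ 2 :=
      fun z' => (norm_sub_le _ _).trans (add_le_add (b0 z) (b0 z'))
    refine (norm_integral_le_of_norm_le ((integrable_const _).add (in2.const_mul (M * s ^ 2)))
      (.of_forall b)).trans ?_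
    rw [integral_add' (integrable_const _) (in2.const_mul (M * s ^ 2)), integral_const_mul (M * s ^ 2) (fun z : E => ‖z‖ ^ 2), ← hq2]
    simp only [integral_const, probReal_univ, one_smul, hA']
    have h1 : ‖z‖ ^ 2 + q2 ≤ (1 + q2) * (1 + ‖z‖) ^ 2 := by
      have := norm_nonneg z
      have : 0 ≤ q2 * (‖z‖ ^ 2 + 2 * ‖z‖) := by positivity
      nlinarith
    have := mul_le_mul_of_nonneg_left h1 (show 0 ≤ M * s ^ 2 by positivity)
    linarith
  have key : ∀ z, Real.exp (g (x + s • z) - G) ≤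
      1 + (g (x + s • z) - G) + s ^ 2 / 2 * (p x z) ^ 2 + s ^ 3 * H z := by
    intro z
    have h1 := hD1 z
    have h2 := hD2 z
    set D := g (x + s • z) - G
    set w := 1 + ‖z‖ with hw
    have w0 : 1 ≤ w := by simp [hw]
    have hpz : |s * p x z| ≤ s * L * w := by
      rw [abs_mul, abs_of_nonneg hs0, mul_assoc]
      refine mul_le_mul_of_nonneg_left ?_ hs0
      refine ((p x).le_opNorm z).trans (mul_le_mul (hg.pbd x) ?_ (norm_nonneg _) hL)
      simp [hw]
    have hD2' : D ^ 2 ≤ (s * p x z) ^ 2 + s ^ 3 * (2 * L * A' * w ^ 3 + A' ^ 2 * w ^ 4) := by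
      set e := D - s * p x z with he
      have : D = s * p x z + e := by rw [he]; ring
      have a1 : s * p x z * e ≤ (s * L * w) * (s ^ 2 * A' * w ^ 2) := by
        refine (le_abs_self _).trans ?_
        rw [abs_mul]
        exact mul_le_mul hpz h2 (abs_nonneg _) (by positivity)
      have a2 : e ^ 2 ≤ (s ^ 2 * A' * w ^ 2) ^ 2 := by
        rw [← sq_abs]; exact pow_le_pow_left₀ (abs_nonneg _) h2 2
      have a3 : (s ^ 2 * A' * w ^ 2) ^ 2 ≤ s ^ 3 * (A' ^ 2 * w ^ 4) := by
        have : (s ^ 2 * A' * w ^ 2) ^ 2 = s * (s ^ 3 * (A' ^ 2 * w ^ 4)) := by ring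
        rw [this]
        exact mul_le_of_le_one_left (by positivity) hs1
      rw [this]
      nlinarith
    have hD3 : |D| ^ 3 * Real.exp |D| ≤ s ^ 3 * (A ^ 3 * w ^ 3 * Real.exp (A * w)) := by
      have : |D| ^ 3 ≤ (s * A * w) ^ 3 := pow_le_pow_left₀ (abs_nonneg _) h1 3
      have h4 : Real.exp |D| ≤ Real.exp (A * w) := by
        refine Real.exp_le_exp.2 (h1.trans ?_)
        rw [mul_assoc]
        exact mul_le_of_le_one_left (by positivity) hs1
      calc _ ≤ (s * A * w) ^ 3 * Real.exp (A * w) :=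
            mul_le_mul this h4 (Real.exp_pos _).le (by positivity)
        _ = _ := by ring
    have := exp_taylor_le D
    have p4 : 0 ≤ s ^ 3 * (A' ^ 2 * w ^ 4) := by positivity
    simp only [hH, ← hw]
    linarith
  have iD : Integrable (fun z => g (x + s • z) - G) γ := ig.sub (integrable_const _)
  have ie : Integrable (fun z => Real.exp (g (x + s • z) - G)) γ := by
    refine integrable_bdd (Real.exp (C - G)) (by fun_prop) (fun z => ?_)
    rw [Real.norm_eq_abs, abs_of_pos (Real.exp_pos _)]
    exact Real.exp_le_exp.2 (by linarith [(abs_le.1 (hg.bdd (x + s • z))).2])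
  have i1 : Integrable (fun z => 1 + (g (x + s • z) - G)) γ := (integrable_const _).add iD
  have i2 : Integrable (fun z => s ^ 2 / 2 * (p x z) ^ 2) γ := ipz2.const_mul _
  have i3 : Integrable (fun z => s ^ 3 * H z) γ := iH.const_mul _
  have i12 : Integrable (fun z => 1 + (g (x + s • z) - G) + s ^ 2 / 2 * (p x z) ^ 2) γ :=
    i1.add i2
  have hI := integral_mono ie (i12.add i3) key
  rw [integral_add' i12 i3, integral_add i1 i2, integral_add (integrable_const _) iD,
    integral_sub ig (integrable_const _), integral_const_mul, integral_const_mul, pz2, ← hGe] at hI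
  simp only [integral_const, probReal_univ, one_smul, sub_self, add_zero] at hI
  have hE : gT s (fun x => Real.exp (g x)) x = Real.exp G * ∫ z, Real.exp (g (x + s • z) - G) ∂γ := by
    rw [← integral_const_mul, gT]
    congr 1; ext z
    rw [← Real.exp_add]; congr 1; ring
  rw [hE, Real.exp_add]
  refine mul_le_mul_of_nonneg_left (hI.trans ?_) (Real.exp_pos _).le
  have hp2 : ‖p x‖ ^ 2 ≤ L ^ 2 := pow_le_pow_left₀ (norm_nonneg _) (hg.pbd x) 2
  have := mul_le_mul_of_nonneg_left hp2 (show 0 ≤ s ^ 2 / 2 by positivity)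
  have := Real.add_one_le_exp (s ^ 2 * L ^ 2 / 2 + s ^ 3 * ∫ z, H z ∂γ)
  linarith

lemma doubling (L M C : ℝ) (s c : ℝ)
    (hA : ∀ (g : E → ℝ) (p : E → StrongDual ℝ E), GoodFn L M C g p → ∀ x,
      gT s (fun x => Real.exp (g x)) x ≤ Real.exp (gT s g x + c))
    (g : E → ℝ) (p : E → StrongDual ℝ E) (hg : GoodFn L M C g p) (x : E) :
    gT (√2 * s) (fun x => Real.exp (g x)) x ≤ Real.exp (gT (√2 * s) g x + 2 * c) := by
  have cg : Continuous g := cont_of_lip hg.lip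
  have hs := hg.smooth s
  have cs : Continuous (gT s g) := cont_of_lip hs.lip
  have eb : ∀ {g : E → ℝ} {p}, GoodFn L M C g p → ∀ x, |Real.exp (g x)| ≤ Real.exp C := by
    intro g p hg x
    rw [abs_of_pos (Real.exp_pos _)]
    exact Real.exp_le_exp.2 (abs_le.1 (hg.bdd x)).2
  rw [← gauss_rot s g cg C hg.bdd, ← gauss_rot s (fun x => Real.exp (g x)) (by fun_prop)
    (Real.exp C) (eb hg)]
  have h2 := hA _ _ hs x
  have h1 : gT s (gT s fun x => Real.exp (g x)) x ≤
      Real.exp c * gT s (fun x => Real.exp (gT s g x)) x := by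
    rw [gT, gT, ← integral_const_mul]
    refine integral_mono_of_nonneg (.of_forall fun z => ?_) ?_ (.of_forall fun z => ?_)
    · exact integral_nonneg fun _ => (Real.exp_pos _).le
    · refine Integrable.const_mul ?_ _
      exact integrable_bdd (Real.exp C) (by fun_prop) (fun _ => eb hs _)
    · have := hA g p hg (x + s • z)
      rw [Real.exp_add, mul_comm] at this
      exact this
  refine h1.trans ((mul_le_mul_of_nonneg_left h2 (Real.exp_pos _).le).trans ?_)
  rw [← Real.exp_add]
  exact Real.exp_le_exp.2 (by linarith)

lemma doubling_iter (L M C : ℝ) (s c : ℝ)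
    (hA : ∀ (g : E → ℝ) (p : E → StrongDual ℝ E), GoodFn L M C g p → ∀ x,
      gT s (fun x => Real.exp (g x)) x ≤ Real.exp (gT s g x + c)) (k : ℕ) :
    ∀ (g : E → ℝ) (p : E → StrongDual ℝ E), GoodFn L M C g p → ∀ x,
    gT (√2 ^ k * s) (fun x => Real.exp (g x)) x ≤ Real.exp (gT (√2 ^ k * s) g x + 2 ^ k * c) := by
  induction k with
  | zero => simpa using hA
  | succ k ih =>
    intro g p hg x
    have := doubling L M C _ _ ih g p hg x
    rwa [← mul_assoc, ← mul_assoc, ← pow_succ', ← pow_succ'] at this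

lemma good_mgf (L M C : ℝ) (hL : 0 ≤ L) (hM : 0 ≤ M) (g : E → ℝ) (p : E → StrongDual ℝ E)
    (hg : GoodFn L M C g p) :
    ∫ z, Real.exp (g z) ∂(stdGaussian E) ≤
      Real.exp (∫ z, g z ∂(stdGaussian E) + L ^ 2 / 2) := by
  obtain ⟨Q, hQ, hb⟩ := base_bound (E := E) L M C hL hM
  have h2 : (0 : ℝ) < √2 := by positivity
  have hk : ∀ k : ℕ, ∫ z, Real.exp (g z) ∂(stdGaussian E) ≤
      Real.exp (∫ z, g z ∂(stdGaussian E) + (L ^ 2 / 2 + ((√2)⁻¹) ^ k * Q)) := by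
    intro k
    have hs1 : ((√2)⁻¹) ^ k ≤ 1 := pow_le_one₀ (by positivity)
      (inv_le_one_of_one_le₀ (Real.one_le_sqrt.2 (by norm_num)))
    have := doubling_iter L M C _ _ (fun g p hg x => hb g p hg (((√2)⁻¹) ^ k) (by positivity) hs1 x)
      k g p hg 0
    have e1 : √2 ^ k * (√2)⁻¹ ^ k = 1 := by
      rw [← mul_pow, mul_inv_cancel₀ h2.ne', one_pow]
    have e2 : (2:ℝ) ^ k = √2 ^ k * √2 ^ k := by
      rw [← mul_pow, Real.mul_self_sqrt (by norm_num)]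
    rw [e1, e2] at this
    simp only [gT, one_smul, zero_add] at this
    refine this.trans (le_of_eq ?_)
    congr 2
    set a := √2 ^ k
    set b := (√2)⁻¹ ^ k
    calc a * a * (b ^ 2 * L ^ 2 / 2 + b ^ 3 * Q) = (a * b) ^ 2 * (L ^ 2 / 2 + b * Q) := by ring
      _ = _ := by rw [e1]; ring
  have ht : Filter.Tendsto (fun k : ℕ => Real.exp (∫ z, g z ∂(stdGaussian E) +
      (L ^ 2 / 2 + ((√2)⁻¹) ^ k * Q))) Filter.atTop
      (nhds (Real.exp (∫ z, g z ∂(stdGaussian E) + (L ^ 2 / 2 + 0 * Q)))) := by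
    refine (Real.continuous_exp.tendsto _).comp (Filter.Tendsto.const_add _
      (Filter.Tendsto.const_add _ (Filter.Tendsto.mul_const _ ?_)))
    refine tendsto_pow_atTop_nhds_zero_of_lt_one (by positivity) ?_
    exact inv_lt_one_of_one_lt₀ (by rw [Real.lt_sqrt] <;> norm_num)
  have := ge_of_tendsto' ht hk
  simpa using this

lemma conv_facts (f : E → ℝ) (cf : Continuous f) (μ : Measure E) [μ.IsAddHaarMeasure]
    (φ : ContDiffBump (0 : E)) :
    ∃ (g : E → ℝ) (p : E → StrongDual ℝ E), (∀ x, HasFDerivAt g (p x) x) ∧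
      (∀ x, g x = ∫ t, φ.normed μ t * f (x - t) ∂μ) ∧
      (∀ x, p x = ∫ t, f (x - t) • fderiv ℝ (φ.normed μ) t ∂μ) ∧
      (∀ x ε, (∀ y ∈ Metric.ball x φ.rOut, |f y - f x| ≤ ε) → |g x - f x| ≤ ε) := by
  refine ⟨φ.normed μ ⋆[ContinuousLinearMap.lsmul ℝ ℝ, μ] f,
    fderiv ℝ (φ.normed μ) ⋆[(ContinuousLinearMap.lsmul ℝ ℝ).precompL E, μ] f, fun x => ?_,
    fun x => ?_, fun x => ?_, fun x ε h => ?_⟩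
  · exact φ.hasCompactSupport_normed.hasFDerivAt_convolution_left _ (φ.contDiff_normed (n := 1))
      cf.locallyIntegrable x
  · simp [convolution_def]
  · rw [convolution_def]
    congr 1; ext t h
    simp [ContinuousLinearMap.precompL_apply, mul_comm]
  · exact φ.dist_normed_convolution_le (μ := μ) cf.aestronglyMeasurable h

lemma good_of_lip (L M C : ℝ) (hL : 0 ≤ L) (hM : 0 ≤ M) (g : E → ℝ) (p : E → StrongDual ℝ E)
    (hder : ∀ x, HasFDerivAt g (p x) x) (glip : ∀ x y, |g x - g y| ≤ L * ‖x - y‖)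
    (hb : ∀ x, |g x| ≤ C) (plip : ∀ x y, ‖p x - p y‖ ≤ M * ‖x - y‖) : GoodFn L M C g p := by
  refine ⟨glip, hb, fun x => ?_, plip, fun x h => ?_⟩
  · have := (hder x).le_of_lipschitz (C := L.toNNReal)
      (LipschitzWith.of_dist_le_mul fun x y => by
        rw [Real.dist_eq, dist_eq_norm, Real.coe_toNNReal L hL]; exact glip x y)
    rwa [Real.coe_toNNReal L hL] at this
  · have := (convex_closedBall x ‖h‖).norm_image_sub_le_of_norm_hasFDerivWithin_le'
      (f := g) (f' := p) (φ := p x) (C := M * ‖h‖) (x := x) (y := x + h)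
      (fun y _ => (hder y).hasFDerivWithinAt) (fun y hy => ?_) (by simp) (by simp)
    · rw [add_sub_cancel_left, Real.norm_eq_abs] at this
      linarith
    · refine (plip y x).trans (mul_le_mul_of_nonneg_left ?_ (by positivity))
      rw [← dist_eq_norm]; exact hy

lemma glip_conv (L : ℝ) (f g : E → ℝ) (hf : ∀ x y, |f x - f y| ≤ L * ‖x - y‖) (cf : Continuous f)
    (μ : Measure E) [IsFiniteMeasureOnCompacts μ] (ρ : E → ℝ) (cρ : Continuous ρ)
    (sρ : HasCompactSupport ρ) (nρ : ∀ x, 0 ≤ ρ x) (eρ : ∫ x, ρ x ∂μ = 1)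
    (hgx : ∀ x, g x = ∫ t, ρ t * f (x - t) ∂μ) (x y : E) : |g x - g y| ≤ L * ‖x - y‖ := by
  have iρ : Integrable ρ μ := cρ.integrable_of_hasCompactSupport sρ
  have ig : ∀ x, Integrable (fun t => ρ t * f (x - t)) μ := fun x =>
    Continuous.integrable_of_hasCompactSupport (by fun_prop) sρ.mul_right
  rw [hgx, hgx, ← integral_sub (ig x) (ig y), ← Real.norm_eq_abs]
  have : ∀ t, ‖ρ t * f (x - t) - ρ t * f (y - t)‖ ≤ ρ t * (L * ‖x - y‖) := by
    intro t
    rw [← mul_sub, norm_mul, Real.norm_eq_abs, abs_of_nonneg (nρ t)]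
    refine mul_le_mul_of_nonneg_left ?_ (nρ t)
    simpa using hf (x - t) (y - t)
  refine (norm_integral_le_of_norm_le (iρ.mul_const _) (.of_forall this)).trans ?_
  rw [integral_mul_const, eρ, one_mul]

lemma plip_conv {F : Type*} [NormedAddCommGroup F] [NormedSpace ℝ F] 
    (L : ℝ) (f : E → ℝ) (p : E → F) (hf : ∀ x y, |f x - f y| ≤ L * ‖x - y‖)
    (cf : Continuous f)
    (μ : Measure E) [IsFiniteMeasureOnCompacts μ] (ρ : E → F) (cρ : Continuous ρ)
    (sρ : HasCompactSupport ρ) 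
    (hpx : ∀ x, p x = ∫ t, f (x - t) • ρ t ∂μ) (x y : E) :
    ‖p x - p y‖ ≤ (L * ∫ t, ‖ρ t‖ ∂μ) * ‖x - y‖ := by
  have iρ : Integrable ρ μ := cρ.integrable_of_hasCompactSupport sρ
  have ip : ∀ x, Integrable (fun t => f (x - t) • ρ t) μ := fun x =>
    Continuous.integrable_of_hasCompactSupport (by fun_prop) sρ.smul_left
  rw [hpx, hpx, ← integral_sub (ip x) (ip y)]
  have : ∀ t, ‖f (x - t) • ρ t - f (y - t) • ρ t‖ ≤ (L * ‖x - y‖) * ‖ρ t‖ := by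
    intro t
    rw [← sub_smul, norm_smul]
    refine mul_le_mul_of_nonneg_right ?_ (norm_nonneg _)
    simpa using hf (x - t) (y - t)
  refine (norm_integral_le_of_norm_le (iρ.norm.const_mul _) (.of_forall this)).trans ?_
  rw [integral_const_mul]
  linarith

lemma exists_mollify_aux (L C : ℝ) (hL : 0 ≤ L) (f : E → ℝ)
    (hf : ∀ x y, |f x - f y| ≤ L * ‖x - y‖)
    (hb : ∀ x, |f x| ≤ C) (ε : ℝ) (μ : Measure E) [μ.IsAddHaarMeasure]
    (φ : ContDiffBump (0 : E)) (hφ : φ.rOut = ε) :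
    ∃ M, 0 ≤ M ∧ ∃ (g : E → ℝ) (p : E → StrongDual ℝ E), GoodFn L M (C + L * ε) g p ∧
      ∀ x : E, |g x - f x| ≤ L * ε := by
  have cf : Continuous f := cont_of_lip hf
  obtain ⟨g, p, hder, hgx, hpx, hgf0⟩ := conv_facts f cf μ φ
  have cρ : ContDiff ℝ 1 (φ.normed μ) := φ.contDiff_normed
  have sρ : HasCompactSupport (φ.normed μ) := φ.hasCompactSupport_normed
  have hgf : ∀ x, |g x - f x| ≤ L * ε := by
    intro x
    refine hgf0 x (L * ε) (fun y hy => ?_)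
    refine (hf y x).trans (mul_le_mul_of_nonneg_left ?_ hL)
    rw [← dist_eq_norm, ← hφ]; exact (Metric.mem_ball.1 hy).le
  have cρ' : Continuous (fderiv ℝ (φ.normed μ)) := cρ.continuous_fderiv one_ne_zero
  have sρ' : HasCompactSupport (fderiv ℝ (φ.normed μ)) := sρ.fderiv ℝ
  have glip := glip_conv L f g hf cf μ _ cρ.continuous sρ φ.nonneg_normed φ.integral_normed hgx
  have plip := plip_conv L f p hf cf μ _ cρ' sρ' hpx
  have I0 : 0 ≤ ∫ t, ‖fderiv ℝ (φ.normed μ) t‖ ∂μ := integral_nonneg fun _ => norm_nonneg _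
  have M0 := mul_nonneg hL I0
  refine ⟨_, M0, g, p, good_of_lip L _ _ hL M0 g p hder glip (fun x => ?_) plip, hgf⟩
  have h1 := abs_le.1 (hgf x)
  have h2 := abs_le.1 (hb x)
  exact abs_le.2 ⟨by linarith, by linarith⟩

lemma exists_mollify (L C : ℝ) (hL : 0 ≤ L) (f : E → ℝ) (hf : ∀ x y, |f x - f y| ≤ L * ‖x - y‖)
    (hb : ∀ x, |f x| ≤ C) (ε : ℝ) (hε : 0 < ε) :
    ∃ M, 0 ≤ M ∧ ∃ g p, GoodFn L M (C + L * ε) g p ∧ ∀ x : E, |g x - f x| ≤ L * ε :=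
  exists_mollify_aux L C hL f hf hb ε Measure.addHaar
    ⟨ε / 2, ε, by positivity, by linarith⟩ rfl

/-- Sharp Gaussian moment generating function bound for bounded Lipschitz functions. -/
lemma lip_mgf (L C : ℝ) (hL : 0 ≤ L) (f : E → ℝ) (hf : ∀ x y, |f x - f y| ≤ L * ‖x - y‖)
    (hb : ∀ x, |f x| ≤ C) :
    ∫ z, Real.exp (f z) ∂(stdGaussian E) ≤
      Real.exp (∫ z, f z ∂(stdGaussian E) + L ^ 2 / 2) := by
  have cf : Continuous f := cont_of_lip hf
  have hk : ∀ ε : ℝ, 0 < ε → ∫ z, Real.exp (f z) ∂(stdGaussian E) ≤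
      Real.exp (∫ z, f z ∂(stdGaussian E) + L ^ 2 / 2 + 2 * (L * ε)) := by
    intro ε hε
    obtain ⟨M, hM, g, p, hg, hgf⟩ := exists_mollify L C hL f hf hb ε hε
    have cg : Continuous g := cont_of_lip hg.lip
    have h1 := good_mgf L M _ hL hM g p hg
    have h2 : ∫ z, g z ∂(stdGaussian E) ≤ ∫ z, f z ∂(stdGaussian E) + L * ε := by
      have := integral_mono (μ := stdGaussian E) (f := g) (g := fun z => f z + L * ε)
        (integrable_bdd _ cg hg.bdd)
        ((integrable_bdd C cf hb).add (integrable_const _))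
        (fun z => by have := (abs_le.1 (hgf z)).2; simp only; linarith)
      rw [integral_add (integrable_bdd C cf hb) (integrable_const _)] at this
      simpa using this
    have h3 : ∫ z, Real.exp (f z) ∂(stdGaussian E) ≤
        Real.exp (L * ε) * ∫ z, Real.exp (g z) ∂(stdGaussian E) := by
      rw [← integral_const_mul]
      refine integral_mono_of_nonneg (.of_forall fun z => (Real.exp_pos _).le) ?_
        (.of_forall fun z => ?_)
      · refine Integrable.const_mul (integrable_bdd (Real.exp (C + L * ε)) (by fun_prop)
          fun z => ?_) _
        rw [Real.norm_eq_abs, abs_of_pos (Real.exp_pos _)]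
        exact Real.exp_le_exp.2 (abs_le.1 (hg.bdd z)).2
      · simp only
        rw [← Real.exp_add]
        exact Real.exp_le_exp.2 (by linarith [(abs_le.1 (hgf z)).1])
    refine h3.trans ((mul_le_mul_of_nonneg_left h1 (Real.exp_pos _).le).trans ?_)
    rw [← Real.exp_add]
    exact Real.exp_le_exp.2 (by linarith)
  have ht : Filter.Tendsto (fun ε : ℝ => Real.exp (∫ z, f z ∂(stdGaussian E) + L ^ 2 / 2 +
      2 * (L * ε))) (nhdsWithin 0 (Set.Ioi 0))
      (nhds (Real.exp (∫ z, f z ∂(stdGaussian E) + L ^ 2 / 2 + 2 * (L * 0)))) :=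
    (Continuous.tendsto (by fun_prop) 0).mono_left nhdsWithin_le_nhds
  have := ge_of_tendsto ht (Filter.eventually_of_mem self_mem_nhdsWithin fun ε hε => hk ε hε)
  simpa using this

/-- Sharp Gaussian concentration for bounded Lipschitz functions. -/
lemma lip_conc (L C t : ℝ) (hL : 0 < L) (ht : 0 ≤ t) (f : E → ℝ)
    (hf : ∀ x y, |f x - f y| ≤ L * ‖x - y‖) (hb : ∀ x, |f x| ≤ C) :
    (stdGaussian E).real {z | ∫ w, f w ∂(stdGaussian E) + t ≤ f z} ≤
      Real.exp (-(t ^ 2 / (2 * L ^ 2))) := by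
  have cf : Continuous f := cont_of_lip hf
  set l := t / L ^ 2 with hl
  have l0 : 0 ≤ l := by positivity
  have h1 := lip_mgf (L * l) (l * C) (by positivity) (fun z => l * f z)
    (fun x y => by
      rw [← mul_sub, abs_mul, abs_of_nonneg l0, mul_comm L l, mul_assoc]
      exact mul_le_mul_of_nonneg_left (hf x y) l0)
    (fun x => by
      rw [abs_mul, abs_of_nonneg l0]
      exact mul_le_mul_of_nonneg_left (hb x) l0)
  have h2 := measure_ge_le_exp_mul_mgf (μ := stdGaussian E) (X := f)
    (∫ w, f w ∂(stdGaussian E) + t) l0 (by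
      refine integrable_bdd (Real.exp (l * C)) (by fun_prop) fun z => ?_
      rw [Real.norm_eq_abs, abs_of_pos (Real.exp_pos _)]
      exact Real.exp_le_exp.2 (mul_le_mul_of_nonneg_left (abs_le.1 (hb z)).2 l0))
  refine h2.trans ((mul_le_mul_of_nonneg_left h1 (Real.exp_pos _).le).trans ?_)
  rw [← Real.exp_add, integral_const_mul]
  refine Real.exp_le_exp.2 (le_of_eq ?_)
  rw [hl]
  field_simp
  ring

end conc

lemma euclNorm_eq {ι : Type*} [Fintype ι] (u : ι → ℝ) : euclNorm u = ‖WithLp.toLp 2 u‖ := by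
  simp [euclNorm, EuclideanSpace.norm_eq]

lemma euclNorm_sq {ι : Type*} [Fintype ι] (u : ι → ℝ) : euclNorm u ^ 2 = ∑ i, u i ^ 2 :=
  Real.sq_sqrt (Finset.sum_nonneg fun _ _ => sq_nonneg _)

lemma euclNorm_nonneg {ι : Type*} [Fintype ι] (u : ι → ℝ) : 0 ≤ euclNorm u := Real.sqrt_nonneg _

lemma euclNorm_mulVec_le {ι κ : Type*} [Fintype ι] [Fintype κ] (A : Matrix ι κ ℝ) (v : κ → ℝ) :
    euclNorm (A.mulVec v) ≤ specNorm A * euclNorm v := by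
  have hb : ∀ v, euclNorm (A.mulVec v) ≤ Real.sqrt (∑ i, ∑ j, A i j ^ 2) * euclNorm v := by
    intro v
    have h0 : 0 ≤ ∑ i, ∑ j, A i j ^ 2 :=
      Finset.sum_nonneg fun _ _ => Finset.sum_nonneg fun _ _ => sq_nonneg _
    rw [euclNorm, euclNorm, ← Real.sqrt_mul h0]
    refine Real.sqrt_le_sqrt ?_
    rw [Finset.sum_mul]
    exact Finset.sum_le_sum fun i _ => Finset.sum_mul_sq_le_sq_mul_sq _ _ _
  have hbdd : BddAbove (Set.range fun x : {x : κ → ℝ // euclNorm x ≤ 1} =>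
      euclNorm (A.mulVec x)) := by
    refine ⟨Real.sqrt (∑ i, ∑ j, A i j ^ 2), ?_⟩
    rintro _ ⟨x, rfl⟩
    exact (hb x).trans (mul_le_of_le_one_right (Real.sqrt_nonneg _) x.2)
  by_cases h0 : euclNorm v = 0
  · have := hb v
    rw [h0, mul_zero] at this ⊢
    exact this
  · have hpos : 0 < euclNorm v := lt_of_le_of_ne (euclNorm_nonneg v) (Ne.symm h0)
    have hsm : ∀ {ι : Type _} [Fintype ι] (a : ℝ) (u : ι → ℝ), 0 ≤ a →
        euclNorm (a • u) = a * euclNorm u := by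
      intro ι _ a u ha
      rw [euclNorm_eq, euclNorm_eq, WithLp.toLp_smul, norm_smul, Real.norm_eq_abs, abs_of_nonneg ha]
    have hsm' : ∀ (a : ℝ) (u : κ → ℝ), 0 ≤ a →
        euclNorm (a • u) = a * euclNorm u := by
      intro a u ha
      rw [euclNorm_eq, euclNorm_eq, WithLp.toLp_smul, norm_smul, Real.norm_eq_abs, abs_of_nonneg ha]
    have := le_ciSup hbdd ⟨(euclNorm v)⁻¹ • v, by
      rw [hsm' _ _ (by positivity), inv_mul_cancel₀ h0]⟩
    simp only [Matrix.mulVec_smul] at this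
    rw [hsm _ _ (by positivity), inv_mul_le_iff₀ hpos] at this
    rw [mul_comm]; exact this

/-- Flattening map into a Euclidean space. -/
def flatMap (N n : ℕ) (V : Fin N → Fin n → ℝ) : PiLp 2 (fun _ : Fin N => EuclideanSpace ℝ (Fin n)) :=
  WithLp.toLp 2 (fun i => WithLp.toLp 2 (V i))

lemma measurable_flatMap (N n : ℕ) : Measurable (flatMap N n) := by
  unfold flatMap
  fun_prop

lemma map_flatMap (N n : ℕ) :
    (Measure.pi fun _ : Fin N => Measure.pi fun _ : Fin n => gaussianReal 0 1).map (flatMap N n) =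
      stdGaussian (PiLp 2 (fun _ : Fin N => EuclideanSpace ℝ (Fin n))) := by
  have h1 : (Measure.pi fun _ : Fin N => Measure.pi fun _ : Fin n => gaussianReal 0 1).map
      (fun V i => (WithLp.toLp 2 (V i) : EuclideanSpace ℝ (Fin n))) =
      Measure.pi fun _ : Fin N => stdGaussian (EuclideanSpace ℝ (Fin n)) := by
    have hi : ∀ _ : Fin N, SigmaFinite ((Measure.pi fun _ : Fin n => gaussianReal 0 1).map
        (WithLp.toLp 2 : (Fin n → ℝ) → EuclideanSpace ℝ (Fin n))) := fun _ => by
      rw [map_pi_eq_stdGaussian]; infer_instance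
    rw [Measure.pi_map_pi (hμ := hi) (fun _ => by fun_prop)]
    simp_rw [map_pi_eq_stdGaussian]
  have h2 : flatMap N n = (WithLp.toLp 2) ∘
      (fun V i => (WithLp.toLp 2 (V i) : EuclideanSpace ℝ (Fin n))) := rfl
  rw [h2, ← Measure.map_map (by fun_prop) (by fun_prop), h1]
  have : IsProbabilityMeasure (Measure.map (WithLp.toLp 2)
    (Measure.pi fun _ : Fin N => stdGaussian (EuclideanSpace ℝ (Fin n)))) :=
    Measure.isProbabilityMeasure_map (by fun_prop)
  apply Measure.ext_of_charFun
  ext t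
  rw [charFun_pi]
  simp_rw [charFun_stdGaussian, ← Complex.exp_sum]
  rw [← Complex.ofReal_pow ‖t‖, PiLp.norm_sq_eq_of_L2]
  simp [Finset.sum_div, neg_div]

lemma map_dot (n : ℕ) (x : Fin n → ℝ) (hx : euclNorm x = 1) :
    (Measure.pi fun _ : Fin n => gaussianReal 0 1).map (fun v => ∑ l, v l * x l) =
      gaussianReal 0 1 := by
  have h2 : (fun v : Fin n → ℝ => ∑ l, v l * x l) =
      (innerSL ℝ (WithLp.toLp 2 x : EuclideanSpace ℝ (Fin n))) ∘ (WithLp.toLp 2) := by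
    ext v
    simp [PiLp.inner_apply]
  rw [h2, ← Measure.map_map (by fun_prop) (by fun_prop), map_pi_eq_stdGaussian,
    IsGaussian.map_eq_gaussianReal, integral_strongDual_stdGaussian, variance_dual_stdGaussian,
    innerSL_apply_norm, ← euclNorm_eq, hx]
  simp

/-- Network output vector. -/
def netU {N n m : ℕ} (c : Fin N → ℝ) (h : Fin m → (Fin n → ℝ) → ℝ) (V : Fin N → Fin n → ℝ) :
    Fin m → ℝ := fun j => ∑ i, c i * h j (V i)

lemma euclNorm_add_le {ι : Type*} [Fintype ι] (u v : ι → ℝ) :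
    euclNorm (fun i => u i - v i) ≤ euclNorm u + euclNorm v := by
  rw [euclNorm_eq, euclNorm_eq, euclNorm_eq]
  exact norm_sub_le (WithLp.toLp 2 u) (WithLp.toLp 2 v)

lemma abs_euclNorm_sub_le {ι : Type*} [Fintype ι] (u v : ι → ℝ) :
    |euclNorm u - euclNorm v| ≤ euclNorm (fun i => u i - v i) := by
  rw [euclNorm_eq, euclNorm_eq, euclNorm_eq]
  exact abs_norm_sub_norm_le (WithLp.toLp 2 u) (WithLp.toLp 2 v)

lemma norm_flat_sq {N n : ℕ} (w : PiLp 2 (fun _ : Fin N => EuclideanSpace ℝ (Fin n))) :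
    ‖w‖ ^ 2 = ∑ i, euclNorm (fun l => w i l) ^ 2 := by
  rw [PiLp.norm_sq_eq_of_L2]
  refine Finset.sum_congr rfl fun i _ => ?_
  rw [euclNorm_eq]

lemma netU_lip {N n m : ℕ} (c : Fin N → ℝ) (h : Fin m → (Fin n → ℝ) → ℝ) (κ B : ℝ) (hκ : 0 ≤ κ)
    (hB : 0 ≤ B) (hc : ∀ i, |c i| = κ) (x : Matrix (Fin m) (Fin n) ℝ)
    (hl : ∀ j v v', |h j v - h j v'| ≤ B * |x.mulVec (v - v') j|) (hS : 0 ≤ specNorm x)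
    (w w' : PiLp 2 (fun _ : Fin N => EuclideanSpace ℝ (Fin n))) :
    |euclNorm (netU c h fun i l => w i l) - euclNorm (netU c h fun i l => w' i l)| ≤
      (κ * B * Real.sqrt N * specNorm x) * ‖w - w'‖ := by
  refine (abs_euclNorm_sub_le _ _).trans ?_
  refine abs_le_of_sq_le_sq' ?_ (by positivity) |>.2
  rw [euclNorm_sq, mul_pow, norm_flat_sq, Finset.mul_sum]
  have h1 : ∀ j, (netU c h (fun i l => w i l) j - netU c h (fun i l => w' i l) j) ^ 2 ≤
      N * ∑ i, (κ * B) ^ 2 * (x.mulVec (fun l => (w - w') i l) j) ^ 2 := by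
    intro j
    rw [netU, netU, ← Finset.sum_sub_distrib]
    have := sq_sum_le_card_mul_sum_sq (s := (Finset.univ : Finset (Fin N)))
      (f := fun i => c i * h j (fun l => w i l) - c i * h j (fun l => w' i l))
    rw [Finset.card_univ, Fintype.card_fin] at this
    refine this.trans (mul_le_mul_of_nonneg_left (Finset.sum_le_sum fun i _ => ?_)
      (Nat.cast_nonneg _))
    rw [← mul_sub, mul_pow, mul_pow, ← sq_abs (c i), hc, mul_assoc]
    refine mul_le_mul_of_nonneg_left ?_ (sq_nonneg _)
    rw [← mul_pow, ← sq_abs, ← sq_abs (B * _), abs_mul B, abs_of_nonneg hB]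
    exact pow_le_pow_left₀ (abs_nonneg _) (hl j _ _) 2
  refine (Finset.sum_le_sum fun j _ => h1 j).trans ?_
  rw [← Finset.mul_sum, Finset.sum_comm, Finset.mul_sum]
  refine Finset.sum_le_sum fun i _ => ?_
  rw [← Finset.mul_sum, ← euclNorm_sq]
  have h2 := pow_le_pow_left₀ (euclNorm_nonneg _) (euclNorm_mulVec_le x (fun l => (w - w') i l)) 2
  have h3 := mul_le_mul_of_nonneg_left h2 (by positivity : 0 ≤ (N : ℝ) * (κ * B) ^ 2)
  have h4 : Real.sqrt N ^ 2 = N := Real.sq_sqrt (Nat.cast_nonneg _)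
  calc _ = _ := by ring
    _ ≤ _ := h3
    _ = _ := by rw [← h4]; simp only [mul_pow, Real.sqrt_sq (Real.sqrt_nonneg _)]; rw [h4]; ring

lemma netU_bdd {N n m : ℕ} (c : Fin N → ℝ) (h : Fin m → (Fin n → ℝ) → ℝ) (κ B : ℝ) (hκ : 0 ≤ κ)
    (hB : 0 ≤ B) (hc : ∀ i, |c i| = κ) (hb : ∀ j v, |h j v| ≤ B) (V : Fin N → Fin n → ℝ) :
    |euclNorm (netU c h V)| ≤ Real.sqrt (∑ _j : Fin m, (N * (κ * B)) ^ 2) := by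
  rw [abs_of_nonneg (euclNorm_nonneg _), euclNorm]
  refine Real.sqrt_le_sqrt (Finset.sum_le_sum fun j _ => ?_)
  rw [← sq_abs]
  refine pow_le_pow_left₀ (abs_nonneg _) ?_ 2
  refine (Finset.abs_sum_le_sum_abs _ _).trans ?_
  refine (Finset.sum_le_card_nsmul _ _ (κ * B) fun i _ => ?_).trans (by simp)
  rw [abs_mul, hc]
  exact mul_le_mul_of_nonneg_left (hb _ _) hκ

lemma netU_mean {N n m : ℕ} (c : Fin N → ℝ) (h : Fin m → (Fin n → ℝ) → ℝ) (κ B : ℝ) (hκ : 0 ≤ κ)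
    (hB : 0 ≤ B) (hc : ∀ i, |c i| = κ) (hb : ∀ j v, |h j v| ≤ B) (ch : ∀ j, Continuous (h j))
    (h0 : ∀ j, ∫ v, h j v ∂(Measure.pi fun _ : Fin n => gaussianReal 0 1) = 0) :
    ∫ V, euclNorm (netU c h V)
      ∂(Measure.pi fun _ : Fin N => Measure.pi fun _ : Fin n => gaussianReal 0 1) ≤
      κ * B * Real.sqrt (m * N) := by
  set ν : Measure (Fin n → ℝ) := Measure.pi fun _ : Fin n => gaussianReal 0 1 with hν
  set P : Measure (Fin N → Fin n → ℝ) := Measure.pi fun _ : Fin N => ν with hP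
  have cU : Continuous fun V => netU c h V := by unfold netU; fun_prop
  have cE : Continuous fun V => euclNorm (netU c h V) := by
    unfold euclNorm
    exact Real.continuous_sqrt.comp (continuous_finsetSum _ fun j _ =>
      ((continuous_apply j).comp cU).pow 2)
  have mE : MemLp (fun V => euclNorm (netU c h V)) 2 P :=
    MemLp.of_bound cE.aestronglyMeasurable _ (.of_forall (netU_bdd c h κ B hκ hB hc hb))
  have mh : ∀ i j, MemLp (fun v => c i * h j v) 2 ν := fun i j =>
    MemLp.of_bound (by have := ch j; fun_prop) (κ * B) (.of_forall fun v => by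
      rw [norm_mul, Real.norm_eq_abs, hc]
      exact mul_le_mul_of_nonneg_left (hb _ _) hκ)
  have hj : ∀ j, Integrable (fun V => netU c h V j ^ 2) P ∧
      ∫ V, netU c h V j ^ 2 ∂P ≤ N * (κ * B) ^ 2 := by
    intro j
    have hpi : ∀ i, MemLp (fun V : Fin N → Fin n → ℝ => c i * h j (V i)) 2 P := fun i =>
      (mh i j).comp_measurePreserving (measurePreserving_eval (fun _ : Fin N => ν) i)
    have hm : MemLp (fun V => netU c h V j) 2 P := memLp_finset_sum _ fun i _ => hpi i
    refine ⟨hm.integrable_sq, ?_⟩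
    have hz : ∫ V, netU c h V j ∂P = 0 := by
      unfold netU
      rw [integral_finset_sum _ fun i _ => (hpi i).integrable (by norm_num)]
      refine Finset.sum_eq_zero fun i _ => ?_
      rw [integral_const_mul]
      have := integral_comp_eval (μ := fun _ : Fin N => ν) (i := i) (f := h j)
        (ch j).aestronglyMeasurable
      rw [hP, this, h0, mul_zero]
    have hv : Var[fun V => netU c h V j; P] = ∫ V, netU c h V j ^ 2 ∂P :=
      variance_of_integral_eq_zero hm.aemeasurable hz
    rw [← hv]
    have hs := variance_sum_pi (μ := fun _ : Fin N => ν) (X := fun i v => c i * h j v)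
      (fun i => mh i j)
    have e : (fun V => netU c h V j) = ∑ i, fun V : Fin N → Fin n → ℝ => c i * h j (V i) := by
      ext V; simp [netU]
    rw [e, hs]
    refine (Finset.sum_le_card_nsmul _ _ ((κ * B) ^ 2) fun i _ => ?_).trans (by simp)
    refine (variance_le_expectation_sq (by have := ch j; fun_prop)).trans ?_
    refine (integral_mono_of_nonneg (.of_forall fun _ => sq_nonneg _) (integrable_const ((κ * B) ^ 2))
      (.of_forall fun v => ?_)).trans (by simp)
    simp only [Pi.pow_apply]
    rw [← sq_abs, abs_mul, hc]
    exact pow_le_pow_left₀ (by positivity) (mul_le_mul_of_nonneg_left (hb _ _) hκ) 2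
  have hsq : (∫ V, euclNorm (netU c h V) ∂P) ^ 2 ≤ ∫ V, euclNorm (netU c h V) ^ 2 ∂P := by
    have h1 := variance_eq_sub mE
    have h2 := variance_nonneg (fun V => euclNorm (netU c h V)) P
    rw [h1] at h2
    simpa using h2
  refine abs_le_of_sq_le_sq' ?_ (by positivity) |>.2
  refine hsq.trans ?_
  simp_rw [euclNorm_sq]
  rw [integral_finset_sum _ fun j _ => (hj j).1]
  refine (Finset.sum_le_sum fun j _ => (hj j).2).trans ?_
  rw [mul_pow (κ * B) (Real.sqrt _), Real.sq_sqrt (by positivity)]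
  simp only [Finset.sum_const, Finset.card_univ, Fintype.card_fin, nsmul_eq_mul]
  exact le_of_eq (by ring)

lemma netU_conc {N n m : ℕ} (c : Fin N → ℝ) (h : Fin m → (Fin n → ℝ) → ℝ) (κ B : ℝ) (hκ : 0 < κ)
    (hB : 0 < B) (hN : 0 < N) (hc : ∀ i, |c i| = κ) (x : Matrix (Fin m) (Fin n) ℝ)
    (hl : ∀ j v v', |h j v - h j v'| ≤ B * |x.mulVec (v - v') j|) (hS : 0 < specNorm x)
    (hb : ∀ j v, |h j v| ≤ B) (ch : ∀ j, Continuous (h j))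
    (h0 : ∀ j, ∫ v, h j v ∂(Measure.pi fun _ : Fin n => gaussianReal 0 1) = 0)
    (t : ℝ) (ht : 0 ≤ t) :
    (Measure.pi fun _ : Fin N => Measure.pi fun _ : Fin n => gaussianReal 0 1).real
      {V | κ * B * Real.sqrt (m * N) + t ≤ euclNorm (netU c h V)} ≤
      Real.exp (-(t ^ 2 / (2 * (κ * B * Real.sqrt N * specNorm x) ^ 2))) := by
  have hN' : 0 < Real.sqrt N := Real.sqrt_pos.2 (by exact_mod_cast hN)
  have hlip := netU_lip c h κ B hκ.le hB.le hc x hl hS.le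
  have hbd := netU_bdd c h κ B hκ.le hB.le hc hb
  have hmean := netU_mean c h κ B hκ.le hB.le hc hb ch h0
  set f : PiLp 2 (fun _ : Fin N => EuclideanSpace ℝ (Fin n)) → ℝ :=
    fun w => euclNorm (netU c h fun i l => w i l) with hf
  have key := lip_conc (κ * B * Real.sqrt N * specNorm x) _ t (by positivity) ht f hlip
    (fun w => hbd _)
  have cf : Continuous f := cont_of_lip hlip
  rw [← map_flatMap] at key
  rw [integral_map (measurable_flatMap N n).aemeasurable cf.aestronglyMeasurable,
    map_measureReal_apply (measurable_flatMap N n)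
      (measurableSet_le measurable_const cf.measurable)] at key
  refine le_trans (measureReal_mono (fun V hV => ?_)) key
  change _ ≤ euclNorm (netU c h V) at hV
  change _ ≤ euclNorm (netU c h V)
  exact le_trans (by gcongr; exact hmean) hV


/-- concentration of the initial misfit.  With each `φ_k` bounded by `B` and
`B`-Lipschitz, unit data `‖x̃_j‖ = 1`, `K‖α‖_∞ ≤ 1`, the centering condition
`Σ_k α_k E_{z∼N(0,1)}[φ_k(z)] = 0`, and `|c_i| = ‖y‖/(K√(mN))` for all `i`, the i.i.d.
standard Gaussian initialization `v_1, …, v_N ∼ N(0, I_{d+1})` satisfies, for every `δ > 0`,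
with probability at least `1 − exp(−mδ²/(2‖X‖²))`, that the initial residual obeys
`‖(u_j − y_j)_j‖ ≤ ‖y‖(1 + (1 + δ)B/K)`, i.e. `√(2L(0)) ≤ ‖y‖(1 + (1 + δ)B/K)`. -/
theorem initial_misfit_concentration {N d K m : ℕ} (B : ℝ) (φ : Fin K → ℝ → ℝ)
    (hbd : ∀ k (s : ℝ), |φ k s| ≤ B)
    (hlip : ∀ k (s s' : ℝ), |φ k s - φ k s'| ≤ B * |s - s'|)
    (xt : Fin m → Fin (d + 1) → ℝ) (hxt : ∀ j, euclNorm (xt j) = 1)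
    (y : Fin m → ℝ) (α : Fin K → ℝ)
    (hα : (K : ℝ) * (⨆ k : Fin K, |α k|) ≤ 1)
    (hcenter : ∑ k, α k * ∫ z, φ k z ∂(gaussianReal 0 1) = 0)
    (c : Fin N → ℝ)
    (hc : ∀ i, |c i| = euclNorm y / ((K : ℝ) * Real.sqrt ((m : ℝ) * N)))
    (δ : ℝ) (hδ : 0 < δ) :
    ENNReal.ofReal (1 - Real.exp (-((m : ℝ) * δ ^ 2) /
        (2 * specNorm (Matrix.of fun (j : Fin m) (l : Fin (d + 1)) => xt j l) ^ 2))) ≤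
      (Measure.pi fun _ : Fin N => Measure.pi fun _ : Fin (d + 1) => gaussianReal 0 1)
        {V | euclNorm (fun j : Fin m =>
            (∑ i, c i * ∑ k, α k * φ k (∑ l, V i l * xt j l)) - y j) ≤
          euclNorm y * (1 + (1 + δ) * B / K)} := by
  set X : Matrix (Fin m) (Fin (d + 1)) ℝ :=
    Matrix.of fun (j : Fin m) (l : Fin (d + 1)) => xt j l with hX
  set h : Fin m → (Fin (d + 1) → ℝ) → ℝ := fun j v => ∑ k, α k * φ k (∑ l, v l * xt j l) with hh
  set κ : ℝ := euclNorm y / ((K : ℝ) * Real.sqrt ((m : ℝ) * N)) with hκdef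
  have hκ : 0 ≤ κ := div_nonneg (euclNorm_nonneg y) (by positivity)
  have hy := euclNorm_nonneg y
  have hα1 : ∑ k, |α k| ≤ 1 := by
    refine le_trans ?_ hα
    refine (Finset.sum_le_card_nsmul _ _ (⨆ k : Fin K, |α k|) fun k _ => ?_).trans (by simp)
    exact le_ciSup (f := fun k => |α k|) (Set.finite_range _).bddAbove k
  have hKB : 0 ≤ (1 + δ) * B / K := by
    rcases Nat.eq_zero_or_pos K with hK | hK
    · simp [hK]
    · have hB : 0 ≤ B := (abs_nonneg _).trans (hbd ⟨0, hK⟩ 0)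
      positivity
  change _ ≤ (Measure.pi fun _ : Fin N => Measure.pi fun _ : Fin (d + 1) => gaussianReal 0 1)
        {V | euclNorm (fun j : Fin m => netU c h V j - y j) ≤
          euclNorm y * (1 + (1 + δ) * B / K)}
  set P : Measure (Fin N → Fin (d + 1) → ℝ) :=
    Measure.pi fun _ : Fin N => Measure.pi fun _ : Fin (d + 1) => gaussianReal 0 1 with hP
  by_cases hdeg : κ = 0 ∨ B ≤ 0 ∨ N = 0 ∨ m = 0
  · have hu : ∀ V, netU c h V = 0 := by
      intro V
      ext j
      rw [netU, Pi.zero_apply]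
      refine Finset.sum_eq_zero fun i _ => ?_
      rcases hdeg with h1 | h1 | h1 | h1
      · have : c i = 0 := abs_eq_zero.1 ((hc i).trans h1)
        rw [this, zero_mul]
      · have : h j (V i) = 0 := by
          refine Finset.sum_eq_zero fun k _ => ?_
          have : φ k (∑ l, V i l * xt j l) = 0 :=
            abs_eq_zero.1 (le_antisymm ((hbd k _).trans h1) (abs_nonneg _))
          rw [this, mul_zero]
        rw [this, mul_zero]
      · subst h1; exact i.elim0
      · subst h1; exact j.elim0
    have : {V | euclNorm (fun j : Fin m => netU c h V j - y j) ≤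
          euclNorm y * (1 + (1 + δ) * B / K)} = Set.univ := by
      refine Set.eq_univ_of_forall fun V => ?_
      rw [Set.mem_setOf_eq, hu]
      refine (euclNorm_add_le 0 y).trans ?_
      have : euclNorm (0 : Fin m → ℝ) = 0 := by simp [euclNorm]
      rw [this, zero_add]
      exact le_mul_of_one_le_right hy (by linarith)
    rw [this, measure_univ]
    exact ENNReal.ofReal_le_one.2 (by linarith [Real.exp_pos (-((m : ℝ) * δ ^ 2) /
        (2 * specNorm X ^ 2))])
  push Not at hdeg
  obtain ⟨hκ0, hB, hN, hm⟩ := hdeg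
  have hκp : 0 < κ := lt_of_le_of_ne hκ (Ne.symm hκ0)
  have hyp : 0 < euclNorm y := by
    refine lt_of_le_of_ne hy fun h0 => hκ0 ?_
    rw [hκdef, ← h0, zero_div]
  have hKp : (0 : ℝ) < K := by
    refine lt_of_le_of_ne (Nat.cast_nonneg _) fun h0 => hκ0 ?_
    rw [hκdef, ← h0, zero_mul, div_zero]
  have hmp : (0 : ℝ) < m := by exact_mod_cast Nat.pos_of_ne_zero hm
  have hNp : (0 : ℝ) < N := by exact_mod_cast Nat.pos_of_ne_zero hN
  have hS : 0 < specNorm X := by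
    let j : Fin m := ⟨0, Nat.pos_of_ne_zero hm⟩
    have h1 := euclNorm_mulVec_le X (xt j)
    rw [hxt, mul_one] at h1
    refine lt_of_lt_of_le ?_ h1
    have h2 : X.mulVec (xt j) j = 1 := by
      have := euclNorm_sq (xt j)
      rw [hxt] at this
      rw [Matrix.mulVec, dotProduct]
      simp only [hX, Matrix.of_apply, ← sq]
      rw [← this]; norm_num
    refine Real.sqrt_pos.2 (Finset.sum_pos' (fun _ _ => sq_nonneg _) ⟨j, Finset.mem_univ _, ?_⟩)
    rw [h2]; norm_num
  have hb : ∀ j v, |h j v| ≤ B := by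
    intro j v
    refine (Finset.abs_sum_le_sum_abs _ _).trans ?_
    calc _ ≤ ∑ k, |α k| * B := Finset.sum_le_sum fun k _ => by
          rw [abs_mul]; exact mul_le_mul_of_nonneg_left (hbd _ _) (abs_nonneg _)
      _ = (∑ k, |α k|) * B := by rw [Finset.sum_mul]
      _ ≤ 1 * B := mul_le_mul_of_nonneg_right hα1 hB.le
      _ = B := one_mul B
  have hl : ∀ j v v', |h j v - h j v'| ≤ B * |X.mulVec (v - v') j| := by
    intro j v v'
    have e : X.mulVec (v - v') j = ∑ l, v l * xt j l - ∑ l, v' l * xt j l := by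
      rw [Matrix.mulVec, dotProduct, ← Finset.sum_sub_distrib]
      refine Finset.sum_congr rfl fun l _ => ?_
      simp only [hX, Matrix.of_apply, Pi.sub_apply]; ring
    rw [e, hh]
    simp only
    rw [← Finset.sum_sub_distrib]
    refine (Finset.abs_sum_le_sum_abs _ _).trans ?_
    set D := |∑ l, v l * xt j l - ∑ l, v' l * xt j l| with hD
    calc _ ≤ ∑ k, |α k| * (B * D) := Finset.sum_le_sum fun k _ => by
          rw [← mul_sub, abs_mul]; exact mul_le_mul_of_nonneg_left (hlip _ _ _) (abs_nonneg _)
      _ = (∑ k, |α k|) * (B * D) := by rw [Finset.sum_mul]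
      _ ≤ 1 * (B * D) := mul_le_mul_of_nonneg_right hα1 (mul_nonneg hB.le (abs_nonneg _))
      _ = B * D := one_mul _
  have cφ : ∀ k, Continuous (φ k) := fun k => cont_of_lip (hlip k)
  have ch : ∀ j, Continuous (h j) := fun j => by
    simp only [hh]
    fun_prop
  have h0 : ∀ j, ∫ v, h j v ∂(Measure.pi fun _ : Fin (d + 1) => gaussianReal 0 1) = 0 := by
    intro j
    have hphi : ∀ k, Integrable (φ k) (gaussianReal 0 1) := fun k =>
      integrable_bdd B (cφ k) (hbd k)
    have e := integral_map (μ := Measure.pi fun _ : Fin (d + 1) => gaussianReal 0 1)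
      (φ := fun v => ∑ l, v l * xt j l) (f := fun s => ∑ k, α k * φ k s)
      (Continuous.aemeasurable (by fun_prop)) (Continuous.aestronglyMeasurable (by fun_prop))
    rw [map_dot _ _ (hxt j)] at e
    simp only [hh]
    rw [← e, integral_finset_sum _ fun k _ => (hphi k).const_mul _]
    refine Eq.trans ?_ hcenter
    exact Finset.sum_congr rfl fun k _ => integral_const_mul _ _
  have key := netU_conc c h κ B hκp hB (Nat.pos_of_ne_zero hN) hc X hl hS hb ch h0
    (δ * B * euclNorm y / K) (by positivity)
  have hκ2 : κ * Real.sqrt (m * N) = euclNorm y / K := by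
    rw [hκdef]
    have : Real.sqrt (m * N) ≠ 0 := (Real.sqrt_pos.2 (by positivity)).ne'
    field_simp
  have hexp : -((δ * B * euclNorm y / K) ^ 2 / (2 * (κ * B * Real.sqrt N * specNorm X) ^ 2)) =
      -((m : ℝ) * δ ^ 2) / (2 * specNorm X ^ 2) := by
    have h1 : (κ * B * Real.sqrt N * specNorm X) ^ 2 =
        (κ ^ 2 * N) * (B * specNorm X) ^ 2 := by
      rw [mul_pow, mul_pow _ (Real.sqrt N), Real.sq_sqrt hNp.le]; ring
    have h2 : κ ^ 2 * N = euclNorm y ^ 2 / (K ^ 2 * m) := by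
      have h3 : κ ^ 2 * (m * N) = (euclNorm y / K) ^ 2 := by
        rw [← hκ2, mul_pow, Real.sq_sqrt (by positivity)]
      rw [eq_div_iff (by positivity)]
      rw [div_pow (euclNorm y) (K : ℝ), eq_div_iff (pow_pos hKp 2).ne'] at h3
      linarith
    rw [h1, h2]
    field_simp
  rw [hexp] at key
  set A : Set (Fin N → Fin (d + 1) → ℝ) :=
    {V | κ * B * Real.sqrt (m * N) + δ * B * euclNorm y / K ≤ euclNorm (netU c h V)} with hA
  have hsub : Aᶜ ⊆ {V | euclNorm (fun j : Fin m => netU c h V j - y j) ≤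
          euclNorm y * (1 + (1 + δ) * B / K)} := by
    intro V hV
    rw [hA, Set.mem_compl_iff, Set.mem_setOf_eq, not_le] at hV
    refine (euclNorm_add_le _ y).trans ?_
    have e : κ * B * Real.sqrt (m * N) + δ * B * euclNorm y / K =
        euclNorm y * ((1 + δ) * B / K) := by
      rw [mul_right_comm, hκ2]; ring
    rw [e] at hV
    linarith
  have hmA : MeasurableSet A := by
    have cE : Continuous fun V => euclNorm (netU c h V) := by
      unfold euclNorm netU
      fun_prop
    exact measurableSet_le measurable_const cE.measurable
  refine le_trans ?_ (measure_mono hsub)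
  rw [← ofReal_measureReal (μ := P) (s := Aᶜ), probReal_compl_eq_one_sub hmA]
  exact ENNReal.ofReal_le_ofReal (by linarith)
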